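/- arXiv:2008.08110 — 2 statements merged into one kernel-verified Lean document; each statement's English description precedes it below -/
import Mathlib

section
/- For every numerical set H with H ≠ ℕ, the associated semigroup of the T-set of H satisfies A(T(H)) = A*(H). -/
open scoped Classical

/-- A numerical set: a subset of ℕ containing 0 with finite complement. -/
def NumericalSet (H : Set ℕ) : Prop := 0 ∈ H ∧ Hᶜ.Finite

/-- A numerical semigroup: a numerical set closed under addition. -/
def NumericalSemigroup (S : Set ℕ) : Prop :=
  NumericalSet S ∧ ∀ a ∈ S, ∀ b ∈ S, a + b ∈ S

/-- Frobenius number: the largest gap. -/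
noncomputable def frob (H : Set ℕ) : ℕ := sSup Hᶜ

/-- Genus: the number of gaps. -/
noncomputable def genus (H : Set ℕ) : ℕ := Hᶜ.ncard

/-- Multiplicity: the smallest nonzero element. -/
noncomputable def mult (H : Set ℕ) : ℕ := sInf {x | x ∈ H ∧ x ≠ 0}

/-- The T-set of a numerical set.  (With truncated subtraction, every `x ≥ frob H`
satisfies `frob H - x = 0`, matching the convention that `F(H) - x` computed in ℤ
is nonpositive, hence not a nonzero element of `H`.) -/
def Tset (H : Set ℕ) : Set ℕ := {x | frob H - x ∉ H ∨ frob H - x = 0}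

/-- The associated numerical semigroup of a numerical set. -/
def A (H : Set ℕ) : Set ℕ := {x | ∀ h ∈ H, x + h ∈ H}

/-- `A*`-operation on numerical sets. -/
def Astar (H : Set ℕ) : Set ℕ := {a | ∀ h ∈ H, h ≠ 0 → a + h ∈ H}

/-- Pseudo-Frobenius numbers of a numerical set. -/
def PF (H : Set ℕ) : Set ℕ := {a | a ∉ H ∧ ∀ h ∈ H, h ≠ 0 → a + h ∈ H}

/-- Type of a numerical set. -/
noncomputable def typ (H : Set ℕ) : ℕ := (PF H).ncard

/-- Almost symmetric: `t(S) = 2 g(S) - F(S)`. -/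
def AlmostSymmetric (S : Set ℕ) : Prop :=
  (typ S : ℤ) = 2 * (genus S : ℤ) - (frob S : ℤ)

/-- An ordinary numerical set: `{0} ∪ {x : x > F(H)}`. -/
def Ordinary (H : Set ℕ) : Prop := H = insert 0 {x : ℕ | frob H < x}

/-- Every natural number above the Frobenius number belongs to the set. -/
theorem NumericalSet.mem_of_frob_lt {H : Set ℕ} (hH : NumericalSet H) {n : ℕ}
    (hn : frob H < n) : n ∈ H := by
  by_contra h
  exact absurd (le_csSup hH.2.bddAbove h) (not_le.mpr hn)

theorem stmt_8 (H : Set ℕ) (hH : NumericalSet H) (hne : H ≠ Set.univ) :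
    A (Tset H) = Astar H := by
  ext x
  constructor
  · intro hx h hh h0
    by_cases hlt : frob H < x + h
    · exact hH.mem_of_frob_lt hlt
    · by_contra hxh
      have ht : frob H - (x + h) ∈ Tset H := by
        left
        rwa [show frob H - (frob H - (x + h)) = x + h by omega]
      have hFh : frob H - (x + (frob H - (x + h))) = h := by omega
      rcases hx _ ht with h1 | h1
      · exact h1 (hFh.symm ▸ hh)
      · exact h0 (hFh.symm.trans h1)
  · intro hx t ht
    by_contra hxt
    obtain ⟨hmem, hpos⟩ : frob H - (x + t) ∈ H ∧ frob H - (x + t) ≠ 0 := by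
      simpa [Tset] using hxt
    have hsum := hx _ hmem hpos
    rw [show x + (frob H - (x + t)) = frob H - t by omega] at hsum
    rcases ht with h1 | h1
    · exact h1 hsum
    · omega
end

section
/- Let S be a non-ordinary numerical semigroup. Then t(S ∪ {F(S)}) = t(S) + t(T(S)) − 1, and in particular t(S ∪ {F(S)}) ≥ t(S). -/
open scoped Classical

/-- Membership in the T-set without truncated subtraction. -/
theorem notMem_Tset_iff {S : Set ℕ} {x : ℕ} :
    x ∉ Tset S ↔ ∃ s ∈ S, s ≠ 0 ∧ x + s = frob S := by
  simp only [Tset, Set.mem_ofPred_eq, not_or, not_not]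
  constructor
  · rintro ⟨h, h0⟩
    exact ⟨_, h, h0, by omega⟩
  · rintro ⟨s, hs, h0, h⟩
    have : frob S - x = s := by omega
    rw [this]
    exact ⟨hs, h0⟩

theorem NumericalSet.mem_of_frob_lt_s12 {S : Set ℕ} (hS : NumericalSet S) {x : ℕ}
    (hx : frob S < x) : x ∈ S := by
  by_contra h
  exact absurd (le_csSup hS.2.bddAbove h) (not_le.mpr hx)

theorem NumericalSet.exists_lt_frob {S : Set ℕ} (hS : NumericalSet S) (hord : ¬ Ordinary S) :
    ∃ s ∈ S, s ≠ 0 ∧ s ≤ frob S := by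
  by_contra! h
  refine hord (Set.ext fun x => ⟨fun hx => ?_, ?_⟩)
  · rcases eq_or_ne x 0 with rfl | h0
    · exact Set.mem_insert _ _
    · exact Set.mem_insert_of_mem _ (h x hx h0)
  · rintro (rfl | hx)
    · exact hS.1
    · exact hS.mem_of_frob_lt_s12 hx

theorem NumericalSet.frob_notMem {S : Set ℕ} (hS : NumericalSet S) (hord : ¬ Ordinary S) :
    frob S ∉ S := by
  refine Nat.sSup_mem (s := Sᶜ) ?_ hS.2.bddAbove
  by_contra! he
  obtain ⟨s, -, h0, hs⟩ := hS.exists_lt_frob hord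
  have : frob S = 0 := by simp [frob, he]
  omega

theorem PF_Tset_nonempty {S : Set ℕ} (h : ∃ s ∈ S, s ≠ 0 ∧ s ≤ frob S) :
    (PF (Tset S)).Nonempty := by
  obtain ⟨hm, h0, hle⟩ := Nat.find_spec h
  refine ⟨frob S - Nat.find h, notMem_Tset_iff.mpr ⟨_, hm, h0, by omega⟩, fun x _ hx0 => ?_⟩
  by_contra hx
  obtain ⟨s, hs, hs0, he⟩ := notMem_Tset_iff.mp hx
  exact Nat.find_min h (m := s) (by omega) ⟨hs, hs0, by omega⟩

theorem PF_Tset_finite (S : Set ℕ) : (PF (Tset S)).Finite := by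
  refine (Set.finite_Iic (frob S)).subset fun a ha => ?_
  obtain ⟨s, -, -, he⟩ := notMem_Tset_iff.mp ha.1
  exact Set.mem_Iic.mpr (by omega)

theorem NumericalSet.frob_mem_PF {S : Set ℕ} (hS : NumericalSet S) (hord : ¬ Ordinary S) :
    frob S ∈ PF S :=
  ⟨hS.frob_notMem hord, fun _ _ h0 => hS.mem_of_frob_lt_s12 (by omega)⟩

theorem disjoint_PF_PF_Tset {S : Set ℕ} (hF : frob S ∉ S) : Disjoint (PF S) (PF (Tset S)) := by
  refine Set.disjoint_left.mpr fun a ha hT => ?_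
  obtain ⟨s, hs, h0, he⟩ := notMem_Tset_iff.mp hT.1
  exact hF (he ▸ ha.2 s hs h0)

theorem NumericalSemigroup.PF_insert_frob {S : Set ℕ} (hS : NumericalSemigroup S)
    (hord : ¬ Ordinary S) :
    PF (insert (frob S) S) = (PF S \ {frob S}) ∪ PF (Tset S) := by
  have hF := hS.1.frob_notMem hord
  ext a
  constructor
  · rintro ⟨ha, h⟩
    rw [Set.mem_insert_iff, not_or] at ha
    by_cases hT : a ∈ Tset S
    · refine Or.inl ⟨⟨ha.2, fun s hs h0 => ?_⟩, ha.1⟩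
      refine (h s (Set.mem_insert_of_mem _ hs) h0).resolve_left fun he => ?_
      exact notMem_Tset_iff.mpr ⟨s, hs, h0, he⟩ hT
    · refine Or.inr ⟨hT, fun x hx hx0 => ?_⟩
      by_contra hax
      obtain ⟨s, hs, h0, he⟩ := notMem_Tset_iff.mp hax
      have has : a + s ∈ S :=
        (h s (Set.mem_insert_of_mem _ hs) h0).resolve_left (by omega)
      have ha0 : a ≠ 0 := fun h => ha.2 (h ▸ hS.1.1)
      exact notMem_Tset_iff.mpr ⟨a + s, has, by omega, by omega⟩ hx
  · have key : a ∉ S → a ≠ frob S → (∀ s ∈ S, s ≠ 0 → a + s ∈ insert (frob S) S) →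
        a ∈ PF (insert (frob S) S) := by
      intro ha haF h
      refine ⟨fun hm => hm.elim haF ha, ?_⟩
      rintro s (rfl | hs) h0
      · have ha0 : a ≠ 0 := fun h => ha (h ▸ hS.1.1)
        exact Set.mem_insert_of_mem _ (hS.1.mem_of_frob_lt_s12 (by omega))
      · exact h s hs h0
    rintro (⟨⟨ha, h⟩, haF⟩ | ⟨ha, h⟩)
    · exact key ha haF fun s hs h0 => Set.mem_insert_of_mem _ (h s hs h0)
    · obtain ⟨k, hk, hk0, he⟩ := notMem_Tset_iff.mp ha
      refine key (fun haS => hF (he ▸ hS.2 a haS k hk)) (by omega) fun s hs h0 => ?_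
      rcases lt_trichotomy s k with hlt | rfl | hgt
      · have hx : k - s ∉ Tset S := fun hx =>
          notMem_Tset_iff.mpr ⟨s, hs, h0, by omega⟩ (h (k - s) hx (by omega))
        obtain ⟨r, hr, -, hr'⟩ := notMem_Tset_iff.mp hx
        have : a + s = r := by omega
        exact Set.mem_insert_of_mem _ (this ▸ hr)
      · exact Or.inl he
      · exact Set.mem_insert_of_mem _ (hS.1.mem_of_frob_lt_s12 (by omega))

theorem stmt_12 (S : Set ℕ) (hS : NumericalSemigroup S) (hord : ¬ Ordinary S) :
    (typ (insert (frob S) S) : ℤ) = (typ S : ℤ) + (typ (Tset S) : ℤ) - 1 ∧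
    typ S ≤ typ (insert (frob S) S) := by
  have hF := hS.1.frob_notMem hord
  have hfin : (PF S).Finite := hS.1.2.subset fun a ha => ha.1
  have hT : 0 < typ (Tset S) :=
    (Set.ncard_pos (PF_Tset_finite S)).mpr (PF_Tset_nonempty (hS.1.exists_lt_frob hord))
  have hsum : typ (insert (frob S) S) = (PF S \ {frob S}).ncard + typ (Tset S) := by
    rw [typ, hS.PF_insert_frob hord]
    exact Set.ncard_union_eq ((disjoint_PF_PF_Tset hF).mono_left Set.sdiff_subset)
      hfin.sdiff (PF_Tset_finite S)
  have hdiff : (PF S \ {frob S}).ncard + 1 = typ S :=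
    Set.ncard_sdiff_singleton_add_one (hS.1.frob_mem_PF hord) hfin
  omega
end
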